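/- Let A ⊆ ℕ be Σ⁰₁ and let G be an infinite finitely generated torsion group with decidable word problem. Then there exists a finitely generated recursively presented torsion group K (with a distinguished finite generating set) such that: T_G(n) ≤ T_K(n) ≤ C · T_G(n) for some constant C ≥ 1 and all n (so T_K = Θ(T_G)); WP(K) conjunctively reduces to A with some rate β growing exponentially (there is c > 1 with β(n) ≥ cⁿ for all sufficiently large n); and A many-one reduces to WP(K). -/

import Mathlib

open Classical in
/-- Characteristic sequence of a set of naturals. -/
noncomputable def charSeq (A : Set ℕ) : ℕ → Bool := fun i => decide (i ∈ A)

/-- The length-`m` prefix of the characteristic sequence of `A`. -/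
noncomputable def charPrefix (A : Set ℕ) (m : ℕ) : List Bool :=
  (List.range m).map (charSeq A)

/-- `A` is Σ⁰₁ (recursively enumerable). -/
def IsSigma01 (A : Set ℕ) : Prop :=
  ∃ f : ℕ →. ℕ, Partrec f ∧ ∀ n, n ∈ A ↔ (f n).Dom

/-- `A` many-one reduces to `B`. -/
def ManyOneRed (A B : Set ℕ) : Prop :=
  ∃ f : ℕ → ℕ, Computable f ∧ ∀ n, n ∈ A ↔ f n ∈ B

/-- `A` is `φ`-impredictable with witness `ψ`. -/
def ImpredictableWith (φ : ℕ → ℕ) (A : Set ℕ) (ψ : ℕ → ℕ) : Prop :=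
  ∀ χ : ℕ × List Bool →. ℕ, Partrec χ →
    ∀ N : ℕ, ∃ p : ℕ, N ≤ p ∧ (ψ p ∈ A ↔ (χ (p, charPrefix A (φ p))).Dom)

/-- `A` is `φ`-impredictable. -/
def Impredictable (φ : ℕ → ℕ) (A : Set ℕ) : Prop :=
  ∃ ψ : ℕ → ℕ, Computable ψ ∧ ImpredictableWith φ A ψ

/-- Bitwise comparison of binary strings of equal length. -/
def bitLE (u v : List Bool) : Prop := List.Forall₂ (· ≤ ·) u v

/-- `B` wtt-reduces to `A` with rate `β`. -/
def WttRedRate (B A : Set ℕ) (β : ℕ → ℕ) : Prop :=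
  Computable β ∧ Monotone β ∧ Filter.Tendsto β Filter.atTop Filter.atTop ∧
  ∃ g : List Bool →. List Bool, Partrec g ∧
    ∀ m : ℕ, ∃ out : List Bool, out ∈ g (charPrefix A m) ∧
      out = charPrefix B out.length ∧ β m ≤ out.length

/-- `B` conjunctively reduces to `A` with rate `β`. -/
def ConjRedRate (B A : Set ℕ) (β : ℕ → ℕ) : Prop :=
  Computable β ∧ Monotone β ∧ Filter.Tendsto β Filter.atTop Filter.atTop ∧
  ∃ g : List Bool → List Bool, Computable g ∧
    (∀ w : List Bool, (g w).length = β w.length) ∧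
    (∀ u v : List Bool, bitLE u v → bitLE (g u) (g v)) ∧
    (∀ m : ℕ, g (charPrefix A m) = charPrefix B (β m)) ∧
    ∃ w : ℕ → ℕ → List Bool, Computable₂ w ∧ (∀ i m, (w i m).length = m) ∧
      ∀ (u v : List Bool) (i : ℕ), u.length = v.length →
        (bitLE (w i u.length) u ↔ bitLE (w i u.length) v) →
        (g u).getD i false = (g v).getD i false

/-- Evaluation of a word over the generators (`true` = generator, `false` = inverse). -/
def evalWord {K : Type*} [Group K] {m : ℕ} (gen : Fin m → K) (w : List (Fin m × Bool)) : K :=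
  (w.map fun l => if l.2 then gen l.1 else (gen l.1)⁻¹).prod

/-- Index of a word in the length-then-lexicographic enumeration of all words
(bijective base-`2m` numeration). -/
def wordCode {m : ℕ} (w : List (Fin m × Bool)) : ℕ :=
  w.foldl (fun acc l => acc * (2 * m) + (2 * l.1.val + (if l.2 then 1 else 0) + 1)) 0

/-- The word problem of a group with distinguished generators. -/
def WordProblem {K : Type*} [Group K] {m : ℕ} (gen : Fin m → K) : Set ℕ :=
  { n | ∃ w : List (Fin m × Bool), wordCode w = n ∧ evalWord gen w = 1 }

/-- Word norm with respect to the distinguished generators. -/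
noncomputable def wordNorm {K : Type*} [Group K] {m : ℕ} (gen : Fin m → K) (g : K) : ℕ :=
  sInf { ℓ | ∃ w : List (Fin m × Bool), w.length = ℓ ∧ evalWord gen w = g }

/-- The torsion function of a group with distinguished generators. -/
noncomputable def torsionFn {K : Type*} [Group K] {m : ℕ} (gen : Fin m → K) (n : ℕ) : ℕ :=
  sSup { k | ∃ g : K, wordNorm gen g ≤ n ∧ orderOf g = k }

/-! ### The central-extension group -/

section GroupPart

/-- The group algebra over the field with two elements. -/
abbrev F2A (G : Type) : Type := MonoidAlgebra (ZMod 2) G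

/-- A group element seen in the group algebra. -/
noncomputable def dl {G : Type} (g : G) : F2A G := MonoidAlgebra.single g 1

open Classical in
/-- Forget the coefficients at the elements of `S`. -/
noncomputable def killMap {G : Type} (S : Set G) : F2A G →+ (G → ZMod 2) where
  toFun x := fun t => if t ∈ S then 0 else x.coeff t
  map_zero' := by ext t; simp
  map_add' x y := by ext t; by_cases h : t ∈ S <;> simp [h]

/-- Upper triangular matrices `[[1, p, c], [0, g, q], [0, 0, 1]]` over the group algebra, with the
corner entry considered modulo the span of `S`. -/
@[ext] structure TriG (G : Type) (S : Set G) where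
  p : F2A G
  g : G
  q : F2A G
  c : G → ZMod 2

variable {G : Type} [Group G] {S : Set G}

theorem dl_mul (g h : G) : dl g * dl h = dl (g * h) := by
  simp [dl, MonoidAlgebra.single_mul_single]

theorem dl_one : dl (1 : G) = 1 := rfl

theorem f2a_add_self (x : F2A G) : x + x = 0 := by
  have h2 : (2 : ZMod 2) = 0 := rfl
  rw [← two_smul (ZMod 2) x, h2, zero_smul]

theorem f2f_add_self {G : Type} (x : G → ZMod 2) : x + x = 0 := by
  ext t; exact CharTwo.add_self_eq_zero _

namespace TriG

noncomputable instance : Mul (TriG G S) :=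
  ⟨fun x y => ⟨y.p + x.p * dl y.g, x.g * y.g, dl x.g * y.q + x.q,
    y.c + killMap S (x.p * y.q) + x.c⟩⟩

noncomputable instance : One (TriG G S) := ⟨⟨0, 1, 0, 0⟩⟩

noncomputable instance : Inv (TriG G S) :=
  ⟨fun x => ⟨-(x.p * dl x.g⁻¹), x.g⁻¹, -(dl x.g⁻¹ * x.q),
    -x.c + killMap S (x.p * dl x.g⁻¹ * x.q)⟩⟩

theorem mul_def (x y : TriG G S) : x * y = ⟨y.p + x.p * dl y.g, x.g * y.g, dl x.g * y.q + x.q,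
    y.c + killMap S (x.p * y.q) + x.c⟩ := rfl

theorem one_def : (1 : TriG G S) = ⟨0, 1, 0, 0⟩ := rfl

theorem inv_def (x : TriG G S) : x⁻¹ = ⟨-(x.p * dl x.g⁻¹), x.g⁻¹, -(dl x.g⁻¹ * x.q),
    -x.c + killMap S (x.p * dl x.g⁻¹ * x.q)⟩ := rfl

noncomputable instance : Group (TriG G S) :=
  Group.ofLeftAxioms
    (by
      intro x y z
      simp only [mul_def]
      ext1
      · simp only [add_mul, mul_assoc, dl_mul, add_assoc]
      · simp only [mul_assoc]
      · simp only [mul_add, ← mul_assoc, dl_mul, add_assoc]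
      · simp only [mul_add, add_mul, map_add, ← mul_assoc]
        abel)
    (by
      intro x
      simp only [mul_def, one_def]
      ext1 <;> simp [dl_one])
    (by
      intro x
      simp only [mul_def, one_def, inv_def]
      ext1
      · simp [mul_assoc, dl_mul, dl_one]
      · simp
      · simp
      · simp [mul_assoc]
        abel)

/-- Projection to `G`. -/
noncomputable def proj : TriG G S →* G where
  toFun x := x.g
  map_one' := rfl
  map_mul' _ _ := rfl

/-- The diagonal copy of `G`. -/
noncomputable def incl : G →* TriG G S where
  toFun g := ⟨0, g, 0, 0⟩
  map_one' := rfl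
  map_mul' _ _ := by simp [mul_def]

theorem incl_injective : Function.Injective (incl : G → TriG G S) := by
  intro a b h
  exact congrArg TriG.g h

theorem pow_four_of_g (x : TriG G S) (h : x.g = 1) : x ^ 4 = 1 := by
  have h2 : x ^ 2 = ⟨0, 1, 0, killMap S (x.p * x.q)⟩ := by
    rw [pow_two, mul_def]
    have := f2f_add_self x.c
    ext1
    · simp [h, dl_one, f2a_add_self]
    · simp [h]
    · simp [h, dl_one, f2a_add_self]
    · rw [add_right_comm, this, zero_add]
  have : x ^ 4 = x ^ 2 * x ^ 2 := by rw [← pow_add]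
  rw [this, h2, mul_def, one_def]
  ext1 <;> simp [f2f_add_self]

theorem pow_eq_one (x : TriG G S) : x ^ (4 * orderOf x.g) = 1 := by
  rw [mul_comm, pow_mul]
  apply pow_four_of_g
  have : (proj (x ^ orderOf x.g) : G) = 1 := by
    rw [map_pow]; exact pow_orderOf_eq_one x.g
  exact this

/-- First extra generator. -/
noncomputable def gX : TriG G S := ⟨1, 1, 0, 0⟩

/-- Second extra generator. -/
noncomputable def gY : TriG G S := ⟨0, 1, 1, 0⟩

theorem gX_inv : (gX : TriG G S)⁻¹ = gX := by
  rw [inv_eq_iff_mul_eq_one, mul_def, one_def]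
  ext1 <;> simp [gX, dl_one, f2a_add_self]

theorem gY_inv : (gY : TriG G S)⁻¹ = gY := by
  rw [inv_eq_iff_mul_eq_one, mul_def, one_def]
  ext1 <;> simp [gY, dl_one, f2a_add_self]

theorem mul_incl (x : TriG G S) (s : G) : x * incl s = ⟨x.p * dl s, x.g * s, x.q, x.c⟩ := by
  rw [mul_def]; ext1 <;> simp [incl]

theorem mul_gX (x : TriG G S) : x * gX = ⟨1 + x.p, x.g, x.q, x.c⟩ := by
  rw [mul_def]; ext1 <;> simp [gX, dl_one]

theorem mul_gY (x : TriG G S) : x * gY = ⟨x.p, x.g, dl x.g + x.q, killMap S x.p + x.c⟩ := by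
  rw [mul_def]; ext1 <;> simp [gY, dl_one]

theorem commutator_word (t : G) :
    (gX * incl t * gY * incl t⁻¹) * (gX * incl t * gY * incl t⁻¹)
      = (⟨0, 1, 0, killMap S (dl t)⟩ : TriG G S) := by
  have h : gX * incl t * gY * incl t⁻¹ = (⟨1, 1, dl t, killMap S (dl t)⟩ : TriG G S) := by
    simp only [mul_gY, mul_incl]
    ext1 <;> simp [gX, dl_mul, dl_one]
  rw [h, mul_def]
  ext1
  · simp [dl_one, f2a_add_self]
  · simp
  · simp [dl_one, f2a_add_self]
  · simp only [one_mul]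
    rw [f2f_add_self, zero_add]

theorem commutator_word_eq_one (t : G) :
    (gX * incl t * gY * incl t⁻¹) * (gX * incl t * gY * incl t⁻¹) = (1 : TriG G S) ↔ t ∈ S := by
  rw [commutator_word, one_def]
  constructor
  · intro h
    by_contra hS
    have h1 := congrFun (congrArg TriG.c h) t
    simp [killMap, hS, dl] at h1
  · intro h
    ext1
    · rfl
    · rfl
    · rfl
    · ext u
      by_cases hu : u ∈ S
      · simp [killMap, hu]
      · have : t ≠ u := fun e => hu (e ▸ h)
        simp [killMap, hu, dl, this]

end TriG

end GroupPart

/-! ### Words and their codes -/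

section Words

/-- Formal inverse of a word. -/
def invWord {m : ℕ} (w : List (Fin m × Bool)) : List (Fin m × Bool) :=
  (w.map fun l => (l.1, !l.2)).reverse

/-- Value of a letter. -/
def letVal {K : Type*} [Group K] {m : ℕ} (gen : Fin m → K) (l : Fin m × Bool) : K :=
  if l.2 then gen l.1 else (gen l.1)⁻¹

variable {K : Type*} [Group K] {m : ℕ} (gen : Fin m → K)

theorem evalWord_nil : evalWord gen [] = 1 := by simp [evalWord]

theorem evalWord_cons (l : Fin m × Bool) (w : List (Fin m × Bool)) :
    evalWord gen (l :: w) = letVal gen l * evalWord gen w := by simp [evalWord, letVal]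

theorem evalWord_append (u v : List (Fin m × Bool)) :
    evalWord gen (u ++ v) = evalWord gen u * evalWord gen v := by simp [evalWord]

theorem evalWord_single (l : Fin m × Bool) : evalWord gen [l] = letVal gen l := by
  simp [evalWord, letVal]

theorem evalWord_inv (w : List (Fin m × Bool)) : evalWord gen (invWord w) = (evalWord gen w)⁻¹ := by
  induction w with
  | nil => simp [invWord, evalWord]
  | cons l w ih =>
    have : invWord (l :: w) = invWord w ++ [(l.1, !l.2)] := by simp [invWord]
    rw [this, evalWord_append, ih, evalWord_single, evalWord_cons, mul_inv_rev]
    rcases l with ⟨i, b⟩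
    cases b <;> simp [letVal]

theorem exists_word (h : Subgroup.closure (Set.range gen) = ⊤) (x : K) :
    ∃ w, evalWord gen w = x := by
  have hx : x ∈ Subgroup.closure (Set.range gen) := h ▸ Subgroup.mem_top x
  induction hx using Subgroup.closure_induction with
  | mem y hy =>
    obtain ⟨i, rfl⟩ := hy
    exact ⟨[(i, true)], by simp [evalWord_single, letVal]⟩
  | one => exact ⟨[], evalWord_nil gen⟩
  | mul y z _ _ hy hz =>
    obtain ⟨u, rfl⟩ := hy
    obtain ⟨v, rfl⟩ := hz
    exact ⟨u ++ v, evalWord_append gen u v⟩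
  | inv y _ hy =>
    obtain ⟨u, rfl⟩ := hy
    exact ⟨invWord u, evalWord_inv gen u⟩

theorem wordNorm_le (w : List (Fin m × Bool)) : wordNorm gen (evalWord gen w) ≤ w.length :=
  Nat.sInf_le ⟨w, rfl, rfl⟩

theorem exists_geodesic (h : Subgroup.closure (Set.range gen) = ⊤) (x : K) :
    ∃ w, w.length = wordNorm gen x ∧ evalWord gen w = x := by
  obtain ⟨w, hw⟩ := exists_word gen h x
  exact Nat.sInf_mem (s := { ℓ | ∃ w : List (Fin m × Bool), w.length = ℓ ∧ evalWord gen w = x })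
    ⟨w.length, w, rfl, hw⟩

theorem exists_wordNorm_eq (h : Subgroup.closure (Set.range gen) = ⊤) [Infinite K] (k : ℕ) :
    ∃ x, wordNorm gen x = k := by
  have h1 : ∃ x, k ≤ wordNorm gen x := by
    by_contra hc
    push Not at hc
    have hfin : (Set.univ : Set K).Finite := by
      refine ((List.finite_length_le (Fin m × Bool) k).image (evalWord gen)).subset ?_
      intro x _
      obtain ⟨w, hw, rfl⟩ := exists_geodesic gen h x
      exact ⟨w, by simpa [hw] using (hc (evalWord gen w)).le, rfl⟩
    exact Set.infinite_univ hfin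
  obtain ⟨x, hx⟩ := h1
  obtain ⟨w, hw, hwx⟩ := exists_geodesic gen h x
  refine ⟨evalWord gen (w.take k), le_antisymm ?_ ?_⟩
  · exact (wordNorm_le gen _).trans (by simp)
  · obtain ⟨u, hu, hux⟩ := exists_geodesic gen h (evalWord gen (w.take k))
    have h2 : evalWord gen (u ++ w.drop k) = x := by
      rw [evalWord_append, hux, ← evalWord_append, List.take_append_drop, hwx]
    have h3 := wordNorm_le gen (u ++ w.drop k)
    rw [h2, List.length_append, List.length_drop, hu, ← hw] at h3
    omega

/-- Digit of a letter. -/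
def letDigit {m : ℕ} (l : Fin m × Bool) : ℕ := 2 * l.1.val + (if l.2 then 1 else 0)

theorem letDigit_lt {m : ℕ} (l : Fin m × Bool) : letDigit l < 2 * m := by
  rcases l with ⟨⟨i, hi⟩, b⟩
  cases b <;> simp [letDigit] <;> omega

theorem letDigit_inj {m : ℕ} (l l' : Fin m × Bool) (h : letDigit l = letDigit l') : l = l' := by
  rcases l with ⟨⟨i, hi⟩, b⟩
  rcases l' with ⟨⟨i', hi'⟩, b'⟩
  cases b <;> cases b' <;> simp [letDigit] at h ⊢ <;> omega

theorem letDigit_surj {m : ℕ} (d : ℕ) (h : d < 2 * m) : ∃ l : Fin m × Bool, letDigit l = d := by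
  refine ⟨(⟨d / 2, by omega⟩, decide (d % 2 = 1)), ?_⟩
  simp only [letDigit, decide_eq_true_eq]
  split_ifs <;> omega

theorem wordCode_concat {m : ℕ} (w : List (Fin m × Bool)) (l : Fin m × Bool) :
    wordCode (w ++ [l]) = wordCode w * (2 * m) + (letDigit l + 1) := by
  simp [wordCode, letDigit, List.foldl_append]

theorem wordCode_injective {m : ℕ} : Function.Injective (wordCode (m := m)) := by
  intro u
  induction u using List.reverseRecOn with
  | nil =>
    intro v h
    induction v using List.reverseRecOn with
    | nil => rfl
    | append_singleton v l _ => rw [wordCode_concat] at h; simp [wordCode] at h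
  | append_singleton u l ih =>
    intro v h
    induction v using List.reverseRecOn with
    | nil => rw [wordCode_concat] at h; simp [wordCode] at h
    | append_singleton v l' _ =>
      rw [wordCode_concat, wordCode_concat, ← add_assoc, ← add_assoc] at h
      have h' := Nat.succ_injective h
      have d1 := letDigit_lt l
      have d2 := letDigit_lt l'
      have e1 : wordCode u = wordCode v := by
        have := congrArg (· / (2 * m)) h'
        simpa [Nat.add_comm, Nat.add_mul_div_right _ _ (show 0 < 2 * m by omega),
          Nat.div_eq_of_lt d1, Nat.div_eq_of_lt d2] using this
      rw [e1] at h'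
      have e2 := letDigit_inj l l' (by omega)
      rw [ih e1, e2]

theorem wordCode_surjective {m : ℕ} (hm : 0 < m) : Function.Surjective (wordCode (m := m)) := by
  intro n
  induction n using Nat.strong_induction_on with
  | _ n ih =>
    rcases n with _ | n
    · exact ⟨[], rfl⟩
    · have hlt : n / (2 * m) < n + 1 := Nat.lt_succ_of_le (Nat.div_le_self _ _)
      obtain ⟨w, hw⟩ := ih _ hlt
      obtain ⟨l, hl⟩ := letDigit_surj (m := m) (n % (2 * m)) (Nat.mod_lt _ (by omega))
      refine ⟨w ++ [l], ?_⟩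
      rw [wordCode_concat, hw, hl]
      have := Nat.div_add_mod' n (2 * m)
      omega

/-- Number of words of length `< n` over `b` letters. -/
def gsum (b : ℕ) : ℕ → ℕ
  | 0 => 0
  | n + 1 => gsum b n * b + 1

theorem gsum_le_code {m : ℕ} (w : List (Fin m × Bool)) :
    gsum (2 * m) w.length ≤ wordCode w ∧ wordCode w < gsum (2 * m) (w.length + 1) := by
  induction w using List.reverseRecOn with
  | nil => simp [gsum, wordCode]
  | append_singleton w l ih =>
    have d1 := letDigit_lt l
    rw [wordCode_concat, List.length_append, List.length_singleton]
    constructor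
    · have := Nat.mul_le_mul_right (2 * m) ih.1
      simp only [gsum]
      omega
    · have := Nat.mul_le_mul_right (2 * m) (Nat.succ_le_of_lt ih.2)
      rw [Nat.succ_mul] at this
      rw [gsum]
      omega

theorem gsum_succ_lt (b : ℕ) (hb : 1 ≤ b) (n : ℕ) : gsum b n < gsum b (n + 1) := by
  have := Nat.mul_le_mul_left (gsum b n) hb
  rw [gsum]; omega

theorem length_le_of_code_le {m : ℕ} (hm : 0 < m) (u v : List (Fin m × Bool))
    (h : wordCode u ≤ wordCode v) : u.length ≤ v.length := by
  by_contra hc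
  push Not at hc
  have hmono := (strictMono_nat_of_lt_succ (gsum_succ_lt (2 * m) (by omega))).monotone
    (Nat.succ_le_of_lt hc)
  have h1 := (gsum_le_code u).1
  have h2 := (gsum_le_code v).2
  simp only [Nat.succ_eq_add_one] at hmono
  omega

theorem two_pow_le_code {m : ℕ} (hm : 0 < m) (w : List (Fin m × Bool)) :
    2 ^ w.length ≤ wordCode w + 1 := by
  have : ∀ n, 2 ^ n ≤ gsum (2 * m) n + 1 := by
    intro n
    induction n with
    | zero => simp [gsum]
    | succ n ih =>
      have := Nat.mul_le_mul_left (gsum (2 * m) n) (show 2 ≤ 2 * m by omega)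
      rw [gsum, pow_succ]; omega
  exact (this _).trans (Nat.succ_le_succ (gsum_le_code w).1)

theorem mem_wordProblem (w : List (Fin m × Bool)) :
    wordCode w ∈ WordProblem gen ↔ evalWord gen w = 1 := by
  constructor
  · rintro ⟨v, hv, h⟩
    rwa [← wordCode_injective hv]
  · intro h; exact ⟨w, rfl, h⟩

/-- The enumeration of words as an equivalence. -/
noncomputable def wordEquiv {m : ℕ} (hm : 0 < m) : List (Fin m × Bool) ≃ ℕ :=
  Equiv.ofBijective wordCode ⟨wordCode_injective, wordCode_surjective hm⟩

theorem wordEquiv_apply {m : ℕ} (hm : 0 < m) (w : List (Fin m × Bool)) :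
    wordEquiv hm w = wordCode w := rfl

theorem wordCode_symm {m : ℕ} (hm : 0 < m) (n : ℕ) : wordCode ((wordEquiv hm).symm n) = n :=
  (wordEquiv hm).apply_symm_apply n

end Words

/-! ### Generalities on computability -/

section Comp

variable {α β σ : Type} [Primcodable α] [Primcodable β] [Primcodable σ]

theorem computable_find {P : α → ℕ → Bool} (hP : Computable₂ P)
    (h : ∀ a, ∃ n, P a n = true) : Computable fun a => Nat.find (h a) := by
  refine (Partrec.rfind (p := fun a n => Part.some (P a n)) hP.partrec₂).of_eq_tot ?_
  intro a
  refine Nat.mem_rfind.2 ⟨?_, ?_⟩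
  · simpa using (Nat.find_spec (h a)).symm
  · intro k hk
    have := Nat.find_min (h a) hk
    simpa using this

theorem computable_symm (e : α ≃ ℕ) (he : Computable e) : Computable e.symm := by
  have hp : Computable₂ fun (n k : ℕ) =>
      (Encodable.decode (α := α) k).bind fun a => if e a = n then some a else none := by
    refine Computable.option_bind (Computable.decode.comp Computable.snd) ?_
    have h1 : Computable fun q : (ℕ × ℕ) × α => decide (e q.2 = q.1.1) :=
      (PrimrecRel.decide Primrec.eq).to_comp.comp (he.comp Computable.snd)
        (Computable.fst.comp Computable.fst)
    refine (Computable.cond h1 (Computable.option_some.comp Computable.snd)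
      (Computable.const none)).of_eq ?_
    intro q
    by_cases hq : e q.2 = q.1.1 <;> simp [hq]
  refine (Partrec.rfindOpt hp).of_eq_tot ?_
  intro n
  have hd : (Nat.rfindOpt fun k => (Encodable.decode (α := α) k).bind
      fun a => if e a = n then some a else none).Dom := by
    rw [Nat.rfindOpt_dom]
    exact ⟨Encodable.encode (e.symm n), e.symm n, by simp⟩
  have hm := Part.get_mem hd
  obtain ⟨k, hk⟩ := Nat.rfindOpt_spec hm
  have : Part.get _ hd = e.symm n := by
    generalize Part.get _ hd = x at hk
    simp only [Option.mem_def, Option.bind_eq_some_iff] at hk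
    obtain ⟨a, -, ha⟩ := hk
    split_ifs at ha with h'
    · cases ha
      rw [← h']; simp
  rwa [this] at hm

theorem computable_list_map {f : α → List β} {g : α → β → σ} (hf : Computable f)
    (hg : Computable₂ g) : Computable fun a => (f a).map (g a) := by
  have hstep : Computable₂ fun (a : α) (q : ℕ × List σ) =>
      (Option.casesOn ((f a)[q.1]?) q.2 (fun b => q.2 ++ [g a b]) : List σ) := by
    refine Computable.option_casesOn
      (Computable.list_getElem?.comp (hf.comp Computable.fst)
        (Computable.fst.comp Computable.snd)) (Computable.snd.comp Computable.snd) ?_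
    exact Computable.list_concat.comp
      (Computable.snd.comp (Computable.snd.comp Computable.fst))
      (hg.comp (Computable.fst.comp Computable.fst) Computable.snd)
  refine (Computable.nat_rec (Computable.list_length.comp hf) (Computable.const []) hstep).of_eq ?_
  intro a
  have key : ∀ n, n ≤ (f a).length → (Nat.rec [] (fun y IH =>
      (Option.casesOn ((f a)[y]?) IH (fun b => IH ++ [g a b]) : List σ)) n : List σ)
        = ((f a).take n).map (g a) := by
    intro n hn
    induction n with
    | zero => simp
    | succ n ih =>
      have hlt : n < (f a).length := hn
      simp only
      rw [ih hlt.le, List.getElem?_eq_getElem hlt, List.take_succ_eq_append_getElem hlt,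
        List.map_append]
      rfl
  simpa using key _ le_rfl

end Comp

/-! ### Conjunctive reductions from a computable list of queries -/

section Queries

theorem primrec_all {σ : Type} [Primcodable σ] {T : ℕ → σ → Bool} (hT : Primrec₂ T) :
    Primrec₂ fun (l : List ℕ) (s : σ) => l.all (fun k => T k s) := by
  have hR : PrimrecRel fun (k : ℕ) (s : σ) => T k s = true := Primrec.eq.comp hT (Primrec.const true)
  refine (PrimrecRel.decide hR.forall_mem_list).of_eq ?_
  intro l s
  rw [Bool.eq_iff_iff]
  simp

theorem computable_req {α σ : Type} [Primcodable α] [Primcodable σ] {T : ℕ → σ → Bool}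
    (hT : Primrec₂ T) {f : α → Option (List ℕ)} {s : α → σ} (hf : Computable f)
    (hs : Computable s) :
    Computable fun a => (Option.casesOn (f a) false (fun l => l.all (fun k => T k (s a))) : Bool) := by
  refine Computable.option_casesOn hf (Computable.const false) ?_
  exact (primrec_all hT).to_comp.comp Computable.snd (hs.comp Computable.fst)

variable {A B : Set ℕ} {F : ℕ → Option (List ℕ)}

theorem sigma_of_queries (hA : IsSigma01 A) (hF : Computable F)
    (hB : ∀ i, i ∈ B ↔ ∃ l, F i = some l ∧ ∀ k ∈ l, k ∈ A) : IsSigma01 B := by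
  obtain ⟨f, hf, hfA⟩ := hA
  obtain ⟨c, rfl⟩ := Nat.Partrec.Code.exists_code.1 (Partrec.nat_iff.1 hf)
  have hT : Primrec₂ fun (k s : ℕ) => (Nat.Partrec.Code.evaln s c k).isSome := by
    refine Primrec.option_isSome.comp ?_
    exact Nat.Partrec.Code.primrec_evaln.comp
      (Primrec.pair (Primrec.pair Primrec.snd (Primrec.const c)) Primrec.fst)
  have hcomp : Computable₂ fun (i s : ℕ) => (Option.casesOn (F i) false
      (fun l => l.all (fun k => (Nat.Partrec.Code.evaln s c k).isSome)) : Bool) :=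
    computable_req (α := ℕ × ℕ) hT (hF.comp Computable.fst) Computable.snd
  have hAs : ∀ k, k ∈ A ↔ ∃ s, (Nat.Partrec.Code.evaln s c k).isSome = true := by
    intro k
    rw [hfA, Part.dom_iff_mem]
    constructor
    · rintro ⟨x, hx⟩
      obtain ⟨s, hs⟩ := Nat.Partrec.Code.evaln_complete.1 hx
      exact ⟨s, Option.isSome_iff_exists.2 ⟨x, hs⟩⟩
    · rintro ⟨s, hs⟩
      obtain ⟨x, hx⟩ := Option.isSome_iff_exists.1 hs
      exact ⟨x, Nat.Partrec.Code.evaln_sound hx⟩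
  have hmono : ∀ k s s', s ≤ s' → (Nat.Partrec.Code.evaln s c k).isSome = true →
      (Nat.Partrec.Code.evaln s' c k).isSome = true := by
    intro k s s' h hs
    obtain ⟨x, hx⟩ := Option.isSome_iff_exists.1 hs
    exact Option.isSome_iff_exists.2 ⟨x, Nat.Partrec.Code.evaln_mono h hx⟩
  refine ⟨fun i => Nat.rfind fun s => Part.some _, Partrec.rfind hcomp.partrec₂, ?_⟩
  intro i
  rw [hB]
  constructor
  · rintro ⟨l, hl, hk⟩
    have : ∃ s, ∀ k ∈ l, (Nat.Partrec.Code.evaln s c k).isSome = true := by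
      clear hl
      induction l with
      | nil => exact ⟨0, by simp⟩
      | cons a l ih =>
        obtain ⟨s, hs⟩ := ih fun k hk' => hk k (List.mem_cons_of_mem _ hk')
        obtain ⟨s', hs'⟩ := (hAs a).1 (hk a List.mem_cons_self)
        refine ⟨max s s', ?_⟩
        intro k hk'
        rcases List.mem_cons.1 hk' with rfl | hk'
        · exact hmono _ _ _ (le_max_right _ _) hs'
        · exact hmono _ _ _ (le_max_left _ _) (hs k hk')
    obtain ⟨s, hs⟩ := this
    obtain ⟨n, hn, -⟩ := Nat.rfind_min' (p := fun s => (Option.casesOn (F i) false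
      (fun l => l.all (fun k => (Nat.Partrec.Code.evaln s c k).isSome)) : Bool)) (m := s)
      (by rw [hl]; simpa using hs)
    exact Part.dom_iff_mem.2 ⟨n, hn⟩
  · intro h
    obtain ⟨n, hn⟩ := Part.dom_iff_mem.1 h
    have := Nat.rfind_spec hn
    have h2 := (Part.mem_some_iff.1 this).symm
    rcases hFi : F i with _ | l
    · rw [hFi] at h2; simp at h2
    · rw [hFi] at h2
      refine ⟨l, rfl, fun k hk => (hAs k).2 ⟨n, ?_⟩⟩
      simp only [List.all_eq_true] at h2
      exact h2 k hk

theorem bitLE_iff (u v : List Bool) : bitLE u v ↔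
    u.length = v.length ∧ ∀ k, u.getD k false = true → v.getD k false = true := by
  rw [bitLE, List.forall₂_iff_get]
  refine and_congr_right fun hl => ⟨fun h k hk => ?_, fun h k h1 h2 => ?_⟩
  · by_cases hku : k < u.length
    · have := h k hku (hl ▸ hku)
      rw [List.getD_eq_getElem _ _ hku] at hk
      rw [List.getD_eq_getElem _ _ (hl ▸ hku)]
      simp only [List.get_eq_getElem] at this
      rw [hk] at this
      exact Bool.eq_true_of_true_le this
    · rw [List.getD_eq_default _ _ (by omega)] at hk
      cases hk
  · have := h k
    rw [List.getD_eq_getElem _ _ h1, List.getD_eq_getElem _ _ h2] at this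
    exact Bool.le_iff_imp.2 this

theorem conj_of_queries (hF : Computable F)
    (hB : ∀ i, i ∈ B ↔ ∃ l, F i = some l ∧ ∀ k ∈ l, k ∈ A)
    (hbd : ∀ i l k m, F i = some l → k ∈ l → i < 2 ^ m → k < m) :
    ConjRedRate B A (fun m => 2 ^ m) := by
  have hpow : Primrec fun m : ℕ => 2 ^ m := by
    refine (Primrec.nat_rec₁ (f := fun _ IH => IH * 2) 1
      (Primrec.nat_mul.comp Primrec.snd (Primrec.const 2))).of_eq ?_
    intro n
    induction n with
    | zero => rfl
    | succ n ih => simp only [pow_succ, ← ih]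
  have hT : Primrec₂ fun (k : ℕ) (u : List Bool) => u.getD k false :=
    (Primrec.list_getD false).comp Primrec.snd Primrec.fst
  let bit : List Bool → ℕ → Bool := fun u i =>
    (Option.casesOn (F i) false (fun l => l.all (fun k => u.getD k false)) : Bool)
  have hbit : Computable₂ bit :=
    computable_req (α := List Bool × ℕ) hT (hF.comp Computable.snd) Computable.fst
  have bit_iff : ∀ u i, bit u i = true ↔ ∃ l, F i = some l ∧ ∀ k ∈ l, u.getD k false = true := by
    intro u i
    simp only [bit]
    rcases hFi : F i with _ | l
    · simp
    · simp
  let g : List Bool → List Bool := fun u => (List.range (2 ^ u.length)).map (bit u)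
  have g_getD : ∀ u i, (g u).getD i false = (decide (i < 2 ^ u.length) && bit u i) := by
    intro u i
    by_cases hi : i < 2 ^ u.length
    · simp [g, hi]
    · rw [List.getD_eq_default _ _ (by simpa [g] using hi)]
      simp [hi]
  have mem_ch : ∀ m k, (charPrefix A m).getD k false = true ↔ k < m ∧ k ∈ A := by
    intro m k
    by_cases hk : k < m
    · simp [charPrefix, charSeq, hk]
    · rw [List.getD_eq_default _ _ (by simpa [charPrefix] using hk)]
      simp [hk]
  refine ⟨hpow.to_comp, fun a b h => Nat.pow_le_pow_right (by norm_num) h,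
    tendsto_pow_atTop_atTop_of_one_lt (by norm_num), g, ?_, ?_, ?_, ?_, ?_⟩
  · exact computable_list_map (Primrec.list_range.to_comp.comp
      (hpow.to_comp.comp Computable.list_length)) hbit
  · intro w; simp [g]
  · intro u v huv
    rw [bitLE_iff] at huv ⊢
    refine ⟨by simp [g, huv.1], fun i => ?_⟩
    rw [g_getD, g_getD, huv.1]
    simp only [Bool.and_eq_true, bit_iff]
    rintro ⟨h1, l, hl, h⟩
    exact ⟨h1, l, hl, fun k hk => huv.2 k (h k hk)⟩
  · intro m
    have hlen : (charPrefix A m).length = m := by simp [charPrefix]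
    simp only [g, hlen]
    rw [show charPrefix B (2 ^ m) = (List.range (2 ^ m)).map (charSeq B) from rfl]
    refine List.map_congr_left fun i hi => ?_
    rw [List.mem_range] at hi
    have hch : charSeq B i = true ↔ i ∈ B := by simp [charSeq]
    rw [Bool.eq_iff_iff, bit_iff, hch, hB]
    refine exists_congr fun l => and_congr_right fun hl => forall₂_congr fun k hk => ?_
    rw [mem_ch]
    exact and_iff_right (hbd i l k m hl hk hi)
  · have hmem : Primrec₂ fun (l : List ℕ) (k : ℕ) => decide (∃ a ∈ l, a = k) :=
      PrimrecRel.decide (PrimrecRel.exists_mem_list Primrec.eq)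
    let w : ℕ → ℕ → List Bool := fun i m =>
      (List.range m).map fun k => decide (∃ a ∈ (F i).getD [], a = k)
    refine ⟨w, ?_, fun i m => by simp [w], ?_⟩
    · refine computable_list_map (α := ℕ × ℕ) (Primrec.list_range.to_comp.comp Computable.snd) ?_
      refine hmem.to_comp.comp ?_ Computable.snd
      exact Computable.option_getD (hF.comp (Computable.fst.comp Computable.fst))
        (Computable.const [])
    · have key : ∀ (u : List Bool) i l, F i = some l → i < 2 ^ u.length →
          (bitLE (w i u.length) u ↔ bit u i = true) := by
        intro u i l hl hi
        rw [bitLE_iff, bit_iff]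
        have hw : ∀ k, (w i u.length).getD k false = true ↔ k < u.length ∧ k ∈ l := by
          intro k
          by_cases hk : k < u.length
          · simp [w, hk, hl]
          · rw [List.getD_eq_default _ _ (by simpa [w] using hk)]
            simp [hk]
        constructor
        · rintro ⟨-, h⟩
          exact ⟨l, hl, fun k hk => h k ((hw k).2 ⟨hbd i l k _ hl hk hi, hk⟩)⟩
        · rintro ⟨l', hl', h⟩
          rw [hl] at hl'
          cases hl'
          exact ⟨by simp [w], fun k hk => h k ((hw k).1 hk).2⟩
      intro u v i huv hiff
      rw [g_getD, g_getD, ← huv]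
      by_cases hi : i < 2 ^ u.length
      · rcases hFi : F i with _ | l
        · have : ∀ u, bit u i = false := by intro u; simp [bit, hFi]
          rw [this, this]
        · have h1 := key u i l hFi hi
          have h2 := key v i l hFi (huv ▸ hi)
          rw [← huv] at h2
          have : bit u i = bit v i := by
            rw [Bool.eq_iff_iff, ← h1, ← h2, hiff]
          rw [this]
      · simp [hi]

end Queries

/-! ### Normal forms in a group with decidable word problem -/

section NormalForm

theorem primrec_wordCode {m : ℕ} : Primrec (wordCode (m := m)) := by
  have hd : Primrec fun l : Fin m × Bool => letDigit l + 1 := Primrec.dom_finite _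
  have : Primrec fun w : List (Fin m × Bool) =>
      w.foldl (fun acc l => acc * (2 * m) + (letDigit l + 1)) 0 := by
    have hs : Primrec₂ fun (_ : List (Fin m × Bool)) (q : ℕ × (Fin m × Bool)) =>
        q.1 * (2 * m) + (letDigit q.2 + 1) :=
      (Primrec.nat_add.comp
        (Primrec.nat_mul.comp (Primrec.fst.comp Primrec.snd) (Primrec.const (2 * m)))
        (hd.comp (Primrec.snd.comp Primrec.snd))).to₂
    exact Primrec.list_foldl Primrec.id (Primrec.const 0) hs
  exact this

theorem primrec_invWord {m : ℕ} : Primrec (invWord (m := m)) := by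
  have hd : Primrec fun l : Fin m × Bool => (l.1, !l.2) := Primrec.dom_finite _
  have hm : Primrec fun w : List (Fin m × Bool) => w.map fun l => (l.1, !l.2) :=
    Primrec.list_map Primrec.id (hd.comp Primrec.snd).to₂
  exact Primrec.list_reverse.comp hm

theorem computable_dec {m : ℕ} (hm : 0 < m) : Computable (wordEquiv hm).symm :=
  computable_symm (wordEquiv hm) primrec_wordCode.to_comp

theorem exists_normal_form {G : Type} [Group G] {m : ℕ} (hm : 0 < m) (gen : Fin m → G)
    (hG : Subgroup.closure (Set.range gen) = ⊤)
    (hdec : ComputablePred (· ∈ WordProblem gen)) :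
    ∃ (ν : List (Fin m × Bool) → ℕ) (lam : ℕ → ℕ), Computable ν ∧ Computable lam ∧
      (∀ u v, ν u = ν v ↔ evalWord gen u = evalWord gen v) ∧
      ∀ u, lam (ν u) = wordNorm gen (evalWord gen u) := by
  obtain ⟨_, hχ⟩ := hdec
  have hcomp : Computable₂ fun (u : List (Fin m × Bool)) (n : ℕ) =>
      decide (wordCode ((wordEquiv hm).symm n ++ invWord u) ∈ WordProblem gen) := by
    refine hχ.comp (primrec_wordCode.to_comp.comp ?_)
    exact Computable.list_append.comp ((computable_dec hm).comp Computable.snd)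
      (primrec_invWord.to_comp.comp Computable.fst)
  have hP : ∀ u n, decide (wordCode ((wordEquiv hm).symm n ++ invWord u) ∈ WordProblem gen) = true
      ↔ evalWord gen ((wordEquiv hm).symm n) = evalWord gen u := by
    intro u n
    rw [decide_eq_true_iff, mem_wordProblem, evalWord_append, evalWord_inv, mul_inv_eq_one]
  have hex : ∀ u, ∃ n, decide
      (wordCode ((wordEquiv hm).symm n ++ invWord u) ∈ WordProblem gen) = true := by
    intro u
    refine ⟨wordEquiv hm u, ?_⟩
    rw [hP, Equiv.symm_apply_apply]
  have hspec : ∀ u, evalWord gen ((wordEquiv hm).symm (Nat.find (hex u))) = evalWord gen u :=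
    fun u => (hP u _).1 (Nat.find_spec (hex u))
  refine ⟨fun u => Nat.find (hex u), fun n => ((wordEquiv hm).symm n).length,
    computable_find hcomp hex, Computable.list_length.comp (computable_dec hm), ?_, ?_⟩
  · intro u v
    constructor
    · intro h
      rw [← hspec u, ← hspec v]
      exact congrArg (fun n => evalWord gen ((wordEquiv hm).symm n)) h
    · intro h
      apply le_antisymm
      · refine Nat.find_min' (hex u) ?_
        rw [hP, hspec, h]
      · refine Nat.find_min' (hex v) ?_
        rw [hP, hspec, h]
  · intro u
    apply le_antisymm
    · obtain ⟨v, hv, hvu⟩ := exists_geodesic gen hG (evalWord gen u)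
      rw [← hv]
      apply length_le_of_code_le hm
      rw [wordCode_symm]
      refine Nat.find_min' (hex u) ?_
      rw [hP, ← wordEquiv_apply hm, Equiv.symm_apply_apply, hvu]
    · have := wordNorm_le gen ((wordEquiv hm).symm (Nat.find (hex u)))
      rwa [hspec] at this

end NormalForm

/-! ### Symbolic evaluation -/

section Symbolic

/-- Words over `m` generators. -/
abbrev Wd (m : ℕ) : Type := List (Fin m × Bool)

/-- Symbolic states. -/
abbrev SymSt (m : ℕ) : Type := List (Wd m) × Wd m × List (Wd m) × List (Wd m)

/-- Letters of the large group that come from the small group. -/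
def toSmall {m : ℕ} (l : Fin (m + 2) × Bool) : Option (Fin m × Bool) :=
  if h : l.1.val < m then some (⟨l.1.val, h⟩, l.2) else none

/-- Letters of the small group in the large group. -/
def toLarge {m : ℕ} (l : Fin m × Bool) : Fin (m + 2) × Bool := (⟨l.1.val, by omega⟩, l.2)

/-- Recognise the first extra generator. -/
def isXLetter {m : ℕ} (l : Fin (m + 2) × Bool) : Bool := decide (l.1.val = m)

/-- One step of the symbolic evaluation. -/
def symStep {m : ℕ} (s : SymSt m) (l : Fin (m + 2) × Bool) : SymSt m :=
  Option.casesOn (toSmall l)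
    (bif isXLetter l then ([] :: s.1, s.2.1, s.2.2.1, s.2.2.2)
      else (s.1, s.2.1, s.2.1 :: s.2.2.1, s.1 ++ s.2.2.2))
    (fun a => (s.1.map (fun u => u ++ [a]), s.2.1 ++ [a], s.2.2.1, s.2.2.2))

/-- The symbolic evaluation. -/
def symRun {m : ℕ} (w : List (Fin (m + 2) × Bool)) : SymSt m := w.foldl symStep ([], [], [], [])

theorem primrec_symStep {m : ℕ} : Primrec₂ (symStep (m := m)) := by
  have h1 : Primrec fun l : Fin (m + 2) × Bool => toSmall l := Primrec.dom_finite _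
  have h2 : Primrec fun l : Fin (m + 2) × Bool => isXLetter l := Primrec.dom_finite _
  have f1 : Primrec fun s : SymSt m => s.1 := Primrec.fst
  have f2 : Primrec fun s : SymSt m => s.2.1 := Primrec.fst.comp Primrec.snd
  have f3 : Primrec fun s : SymSt m => s.2.2.1 := Primrec.fst.comp (Primrec.snd.comp Primrec.snd)
  have f4 : Primrec fun s : SymSt m => s.2.2.2 := Primrec.snd.comp (Primrec.snd.comp Primrec.snd)
  have hX : Primrec fun s : SymSt m => (([] :: s.1, s.2.1, s.2.2.1, s.2.2.2) : SymSt m) :=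
    (Primrec.list_cons.comp (Primrec.const []) f1).pair (f2.pair (f3.pair f4))
  have hY : Primrec fun s : SymSt m => ((s.1, s.2.1, s.2.1 :: s.2.2.1, s.1 ++ s.2.2.2) : SymSt m) :=
    f1.pair (f2.pair ((Primrec.list_cons.comp f2 f3).pair (Primrec.list_append.comp f1 f4)))
  have hmap : Primrec₂ fun (s : SymSt m) (a : Fin m × Bool) => s.1.map (fun u => u ++ [a]) := by
    refine Primrec.list_map (f1.comp Primrec.fst) ?_
    exact Primrec.list_concat.comp Primrec.snd (Primrec.snd.comp Primrec.fst)
  have hS : Primrec₂ fun (s : SymSt m) (a : Fin m × Bool) =>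
      ((s.1.map (fun u => u ++ [a]), s.2.1 ++ [a], s.2.2.1, s.2.2.2) : SymSt m) :=
    Primrec.pair hmap (Primrec.pair
      (Primrec.list_concat.comp (f2.comp Primrec.fst) Primrec.snd)
      (Primrec.pair (f3.comp Primrec.fst) (f4.comp Primrec.fst)))
  refine Primrec.option_casesOn (h1.comp Primrec.snd) ?_ ?_
  · exact Primrec.cond (h2.comp Primrec.snd) (hX.comp Primrec.fst) (hY.comp Primrec.fst)
  · exact hS.comp (Primrec.fst.comp Primrec.fst) Primrec.snd

theorem primrec_symRun {m : ℕ} : Primrec (symRun (m := m)) :=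
  Primrec.list_foldl Primrec.id (Primrec.const _)
    (primrec_symStep.comp (Primrec.fst.comp Primrec.snd) (Primrec.snd.comp Primrec.snd)).to₂

theorem symRun_concat {m : ℕ} (w : List (Fin (m + 2) × Bool)) (l : Fin (m + 2) × Bool) :
    symRun (w ++ [l]) = symStep (symRun w) l := by
  simp [symRun, List.foldl_append]

theorem symRun_bound {m : ℕ} (w : List (Fin (m + 2) × Bool)) :
    (∀ u ∈ (symRun w).1, u.length < w.length) ∧ ∀ u ∈ (symRun w).2.2.2, u.length < w.length := by
  induction w using List.reverseRecOn with
  | nil => simp [symRun]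
  | append_singleton w l ih =>
    obtain ⟨ih1, ih2⟩ := ih
    rw [symRun_concat, List.length_append, List.length_singleton]
    generalize symRun w = s at ih1 ih2
    have e1 : ∀ u ∈ s.1, u.length < w.length + 1 := fun u hu => (ih1 u hu).trans (Nat.lt_succ_self _)
    have e2 : ∀ u ∈ s.2.2.2, u.length < w.length + 1 :=
      fun u hu => (ih2 u hu).trans (Nat.lt_succ_self _)
    unfold symStep
    rcases toSmall l with _ | a
    · cases isXLetter l
      · refine ⟨e1, fun u hu => ?_⟩
        rcases List.mem_append.1 hu with h | h
        · exact e1 u h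
        · exact e2 u h
      · refine ⟨fun u hu => ?_, e2⟩
        rcases List.mem_cons.1 hu with rfl | h
        · simp
        · exact e1 u h
    · refine ⟨fun u hu => ?_, e2⟩
      obtain ⟨v, hv, rfl⟩ := List.mem_map.1 hu
      simpa using ih1 v hv

/-- Elements with odd multiplicity. -/
def oddL (L : List ℕ) : List ℕ := L.filter fun n => decide (L.count n % 2 = 1)

theorem primrec_oddL : Primrec oddL := by
  have hc : Primrec₂ fun (L : List ℕ) (n : ℕ) => L.count n := by
    refine (Primrec.list_length.comp (PrimrecRel.listFilter (R := fun a b : ℕ => a = b)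
      Primrec.eq)).of_eq ?_
    rintro ⟨L, n⟩
    simp only [List.count_eq_length_filter]
    rfl
  have hR : PrimrecRel fun (n : ℕ) (L : List ℕ) => L.count n % 2 = 1 :=
    Primrec.eq.comp (Primrec.nat_mod.comp (hc.comp Primrec.snd Primrec.fst) (Primrec.const 2))
      (Primrec.const 1)
  exact (PrimrecRel.listFilter hR).comp Primrec.id Primrec.id

variable {G : Type} [Group G] {m : ℕ} (gen : Fin m → G) (S : Set G)

/-- The generators of the large group. -/
noncomputable def genT : Fin (m + 2) → TriG G S := fun i =>
  if h : i.val < m then TriG.incl (gen ⟨i.val, h⟩) else if i.val = m then TriG.gX else TriG.gY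

theorem letVal_genT (l : Fin (m + 2) × Bool) : letVal (genT gen S) l =
    Option.casesOn (toSmall l) (bif isXLetter l then TriG.gX else TriG.gY)
      (fun a => TriG.incl (letVal gen a)) := by
  rcases l with ⟨i, b⟩
  by_cases h : i.val < m
  · cases b <;> simp [letVal, genT, toSmall, h]
  · by_cases h' : i.val = m
    · cases b <;> simp [letVal, genT, toSmall, isXLetter, h', TriG.gX_inv]
    · cases b <;> simp [letVal, genT, toSmall, isXLetter, h, h', TriG.gY_inv]

/-- Value of a list of words in the group algebra. -/
noncomputable def lsum (P : List (Wd m)) : F2A G := (P.map fun u => dl (evalWord gen u)).sum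

/-- Value of a symbolic state. -/
noncomputable def symVal (s : SymSt m) : TriG G S :=
  ⟨lsum gen s.1, evalWord gen s.2.1, lsum gen s.2.2.1, killMap S (lsum gen s.2.2.2)⟩

theorem lsum_map_concat (P : List (Wd m)) (a : Fin m × Bool) :
    lsum gen (P.map fun u => u ++ [a]) = lsum gen P * dl (letVal gen a) := by
  induction P with
  | nil => simp [lsum]
  | cons u P ih =>
    simp only [lsum, List.map_cons, List.sum_cons, add_mul] at ih ⊢
    rw [ih, evalWord_append, evalWord_single, dl_mul]

theorem symVal_step (s : SymSt m) (l : Fin (m + 2) × Bool) :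
    symVal gen S (symStep s l) = symVal gen S s * letVal (genT gen S) l := by
  rw [letVal_genT]
  unfold symStep
  rcases toSmall l with _ | a
  · cases isXLetter l
    · simp only [cond_false, TriG.mul_gY]
      ext1 <;> simp [symVal, lsum]
    · simp only [cond_true, TriG.mul_gX]
      ext1 <;> simp [symVal, lsum, evalWord_nil, dl_one]
  · simp only [TriG.mul_incl]
    ext1
    · exact lsum_map_concat gen s.1 a
    · simp [symVal, evalWord_append, evalWord_single]
    · rfl
    · rfl

theorem symVal_run (w : List (Fin (m + 2) × Bool)) :
    symVal gen S (symRun w) = evalWord (genT gen S) w := by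
  induction w using List.reverseRecOn with
  | nil => simp [symRun, symVal, lsum, evalWord_nil, TriG.one_def]
  | append_singleton w l ih =>
    rw [symRun_concat, symVal_step, ih, evalWord_append, evalWord_single]

theorem lsum_coeff {ν : Wd m → ℕ}
    (hν : ∀ u v, ν u = ν v ↔ evalWord gen u = evalWord gen v) (P : List (Wd m)) (v : Wd m) :
    (lsum gen P).coeff (evalWord gen v) = ((P.map ν).count (ν v) : ZMod 2) := by
  induction P with
  | nil => simp [lsum]
  | cons u P ih =>
    have : lsum gen (u :: P) = dl (evalWord gen u) + lsum gen P := by simp [lsum]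
    rw [this, MonoidAlgebra.coeff_add, Finsupp.add_apply, ih, List.map_cons, List.count_cons]
    by_cases h : ν u = ν v
    · have h' := (hν u v).1 h
      simp [h, h', dl, add_comm]
    · have h' : evalWord gen u ≠ evalWord gen v := fun e => h ((hν u v).2 e)
      simp [h, h', dl]

theorem killMap_lsum_eq_zero {ν : Wd m → ℕ}
    (hν : ∀ u v, ν u = ν v ↔ evalWord gen u = evalWord gen v) 
    (hG : Subgroup.closure (Set.range gen) = ⊤) (P : List (Wd m)) :
    killMap S (lsum gen P) = 0 ↔ ∀ u ∈ P, ν u ∈ oddL (P.map ν) → evalWord gen u ∈ S := by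
  have hz : ∀ n : ℕ, (n : ZMod 2) = 0 ↔ n % 2 ≠ 1 := by
    intro n
    rw [ZMod.natCast_eq_zero_iff]
    omega
  constructor
  · intro h u hu ho
    by_contra hS
    have h1 := congrFun h (evalWord gen u)
    simp only [killMap, AddMonoidHom.coe_mk, ZeroHom.coe_mk, hS, if_false, Pi.zero_apply] at h1
    rw [lsum_coeff gen hν, hz] at h1
    simp only [oddL, List.mem_filter, decide_eq_true_eq] at ho
    exact h1 ho.2
  · intro h
    ext t
    obtain ⟨v, rfl⟩ := exists_word gen hG t
    by_cases hS : evalWord gen v ∈ S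
    · simp [killMap, hS]
    · simp only [killMap, AddMonoidHom.coe_mk, ZeroHom.coe_mk, hS, if_false, Pi.zero_apply]
      rw [lsum_coeff gen hν, hz]
      intro hodd
      have hmem : ν v ∈ P.map ν := by
        by_contra hc
        rw [List.count_eq_zero_of_not_mem hc] at hodd
        omega
      obtain ⟨u, hu, huv⟩ := List.mem_map.1 hmem
      apply hS
      rw [← (hν u v).1 huv]
      apply h u hu
      simp only [oddL, List.mem_filter, decide_eq_true_eq]
      rw [huv]
      exact ⟨hmem, hodd⟩

theorem lsum_eq_zero {ν : Wd m → ℕ}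
    (hν : ∀ u v, ν u = ν v ↔ evalWord gen u = evalWord gen v) 
    (hG : Subgroup.closure (Set.range gen) = ⊤) (P : List (Wd m)) :
    lsum gen P = 0 ↔ oddL (P.map ν) = [] := by
  have h1 : lsum gen P = 0 ↔ killMap (∅ : Set G) (lsum gen P) = 0 := by
    constructor
    · intro h; rw [h, map_zero]
    · intro h
      ext t
      simpa [killMap] using congrFun h t
  rw [h1, killMap_lsum_eq_zero gen ∅ hν hG, List.eq_nil_iff_forall_not_mem]
  constructor
  · intro h n hn
    obtain ⟨u, hu, rfl⟩ := List.mem_map.1 (List.mem_of_mem_filter hn)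
    exact h u hu hn
  · intro h u _ hn
    exact absurd hn (h _)

end Symbolic

/-! ### Assembly -/

section Assembly

theorem evalWord_map {K H : Type*} [Group K] [Group H] (f : K →* H) {m : ℕ} (gen : Fin m → K)
    (w : List (Fin m × Bool)) : f (evalWord gen w) = evalWord (fun i => f (gen i)) w := by
  induction w with
  | nil => simp [evalWord_nil]
  | cons l w ih =>
    rw [evalWord_cons, evalWord_cons, map_mul, ih]
    congr 1
    rcases l with ⟨i, b⟩
    cases b <;> simp [letVal]

theorem torsion_bdd {K : Type*} [Group K] {m : ℕ} (gen : Fin m → K)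
    (h : Subgroup.closure (Set.range gen) = ⊤) (n : ℕ) :
    BddAbove { k | ∃ g : K, wordNorm gen g ≤ n ∧ orderOf g = k } := by
  refine (((List.finite_length_le (Fin m × Bool) n).image
    (fun w => orderOf (evalWord gen w))).subset ?_).bddAbove
  rintro k ⟨g, hg, rfl⟩
  obtain ⟨w, hw, rfl⟩ := exists_geodesic gen h g
  exact ⟨w, by simpa [hw] using hg, rfl⟩

theorem torsion_nonempty {K : Type*} [Group K] {m : ℕ} (gen : Fin m → K) (n : ℕ) :
    { k | ∃ g : K, wordNorm gen g ≤ n ∧ orderOf g = k }.Nonempty := by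
  refine ⟨_, 1, ?_, rfl⟩
  have := wordNorm_le gen []
  rw [evalWord_nil] at this
  exact this.trans (Nat.zero_le _)

variable {G : Type} [Group G] {m : ℕ} (gen : Fin m → G) (S : Set G)

theorem evalWord_toSmall (w : List (Fin (m + 2) × Bool)) :
    evalWord gen (w.filterMap toSmall) = (evalWord (genT gen S) w).g := by
  induction w with
  | nil => rfl
  | cons l w ih =>
    have hmul : (evalWord (genT gen S) (l :: w)).g
        = (letVal (genT gen S) l).g * (evalWord (genT gen S) w).g := by
      rw [evalWord_cons]; rfl
    rw [hmul, ← ih, letVal_genT]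
    rcases hl : toSmall l with _ | a
    · rw [List.filterMap_cons_none hl]
      cases isXLetter l <;> simp [TriG.gX, TriG.gY]
    · rw [List.filterMap_cons_some hl, evalWord_cons]
      rfl

theorem evalWord_toLarge (w : List (Fin m × Bool)) :
    evalWord (genT gen S) (w.map toLarge) = TriG.incl (evalWord gen w) := by
  induction w with
  | nil => rfl
  | cons l w ih =>
    rw [List.map_cons, evalWord_cons, ih, evalWord_cons, map_mul, letVal_genT]
    have : toSmall (toLarge l) = some l := by simp [toSmall, toLarge]
    rw [this]

/-- Letter of the first extra generator. -/
def letX (m : ℕ) : Fin (m + 2) × Bool := (⟨m, by omega⟩, true)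

/-- Letter of the second extra generator. -/
def letY (m : ℕ) : Fin (m + 2) × Bool := (⟨m + 1, by omega⟩, true)

/-- Half of the word testing whether a central element dies. -/
def halfWord (u : Wd m) : Wd (m + 2) :=
  [letX m] ++ u.map toLarge ++ [letY m] ++ (invWord u).map toLarge

theorem primrec_halfWord : Primrec (halfWord (m := m)) := by
  have hl : Primrec fun l : Fin m × Bool => toLarge l := Primrec.dom_finite _
  have hm : Primrec fun u : Wd m => u.map toLarge :=
    Primrec.list_map Primrec.id (hl.comp Primrec.snd).to₂
  exact Primrec.list_append.comp (Primrec.list_append.comp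
    (Primrec.list_append.comp (Primrec.const _) hm) (Primrec.const _)) (hm.comp primrec_invWord)

theorem evalWord_halfWord (u : Wd m) : evalWord (genT gen S) (halfWord u ++ halfWord u) = 1 ↔
    evalWord gen u ∈ S := by
  have hx : letVal (genT gen S) (letX m) = TriG.gX := by simp [letVal, genT, letX]
  have hy : letVal (genT gen S) (letY m) = TriG.gY := by simp [letVal, genT, letY]
  rw [← TriG.commutator_word_eq_one, evalWord_append]
  simp only [halfWord, evalWord_append, evalWord_single, evalWord_toLarge, evalWord_inv, hx, hy]

end Assembly

/-- Given a Σ⁰₁ set `A` and an infinite finitely generated torsion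
group `G` with decidable word problem, there is a finitely generated recursively
presented torsion group `K` with `T_K = Θ(T_G)` whose word problem conjunctively
reduces to `A` with exponential rate, and such that `A` many-one reduces to `WP(K)`. -/
theorem construction_theorem (A : Set ℕ) (hA : IsSigma01 A)
    (G : Type) [Group G] {mG : ℕ} (genG : Fin mG → G)
    (hG : Subgroup.closure (Set.range genG) = ⊤)
    (hInf : Infinite G)
    (htG : ∀ g : G, IsOfFinOrder g)
    (hdecG : ComputablePred (· ∈ WordProblem genG)) :
    ∃ (K : Type) (_ : Group K) (mK : ℕ) (genK : Fin mK → K),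
      Subgroup.closure (Set.range genK) = ⊤ ∧
      IsSigma01 (WordProblem genK) ∧
      (∀ g : K, IsOfFinOrder g) ∧
      (∃ C : ℕ, 1 ≤ C ∧ ∀ n : ℕ,
        torsionFn genG n ≤ torsionFn genK n ∧ torsionFn genK n ≤ C * torsionFn genG n) ∧
      (∃ β : ℕ → ℕ, ConjRedRate (WordProblem genK) A β ∧
        ∃ c : ℝ, 1 < c ∧ ∃ N : ℕ, ∀ n ≥ N, c ^ n ≤ (β n : ℝ)) ∧
      ManyOneRed A (WordProblem genK) := by
  classical
  have hm : 0 < mG := by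
    rcases Nat.eq_zero_or_pos mG with rfl | h
    · exfalso
      obtain ⟨x, hx⟩ := exists_wordNorm_eq genG hG 1
      obtain ⟨w, hw, -⟩ := exists_geodesic genG hG x
      rcases w with _ | ⟨l, w⟩
      · simp [hx] at hw
      · exact l.1.elim0
    · exact h
  obtain ⟨ν, lam, hνc, hlamc, hν, hlam⟩ := exists_normal_form hm genG hG hdecG
  -- the big group and the subgroup generated by the distinguished elements
  let S : Set G := {t | wordNorm genG t ∈ A}
  let gT : Fin (mG + 2) → TriG G S := genT genG S
  let K := Subgroup.closure (Set.range gT)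
  let gK : Fin (mG + 2) → K := fun i => ⟨gT i, Subgroup.subset_closure ⟨i, rfl⟩⟩
  have hcoe : ∀ w, ((evalWord gK w : K) : TriG G S) = evalWord gT w := fun w =>
    evalWord_map K.subtype gK w
  have hgen : Subgroup.closure (Set.range gK) = ⊤ := by
    have h1 : Set.range gK = ((↑) : K → TriG G S) ⁻¹' Set.range gT := by
      ext x
      constructor
      · rintro ⟨i, rfl⟩; exact ⟨i, rfl⟩
      · rintro ⟨i, hi⟩; exact ⟨i, Subtype.ext hi⟩
    rw [h1]
    exact Subgroup.closure_closure_coe_preimage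
  have hone : ∀ w, evalWord gK w = 1 ↔ evalWord gT w = 1 := by
    intro w
    rw [← hcoe, ← Subgroup.coe_one K, Subtype.coe_inj]
  -- the queries
  let dec := (wordEquiv (show 0 < mG + 2 by omega)).symm
  let F : ℕ → Option (List ℕ) := fun n =>
    bif decide (oddL ((symRun (dec n)).1.map ν) = []) &&
      (decide (ν (symRun (dec n)).2.1 = ν []) &&
        decide (oddL ((symRun (dec n)).2.2.1.map ν) = []))
    then some ((oddL ((symRun (dec n)).2.2.2.map ν)).map lam) else none
  have hFc : Computable F := by
    have hr : Computable fun n => symRun (dec n) :=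
      primrec_symRun.to_comp.comp (computable_dec _)
    have r2 := Computable.snd.comp hr
    have r3 := Computable.snd.comp r2
    have ho : ∀ {f : ℕ → List (Wd mG)}, Computable f → Computable fun n => oddL ((f n).map ν) :=
      fun hf => primrec_oddL.to_comp.comp (computable_list_map hf (hνc.comp Computable.snd).to₂)
    have hnil : Primrec fun l : List ℕ => decide (l = []) :=
      PrimrecPred.decide (Primrec.eq.comp Primrec.id (Primrec.const []))
    have heq : Primrec₂ fun a b : ℕ => decide (a = b) := PrimrecRel.decide Primrec.eq
    refine Computable.cond ?_ (Computable.option_some.comp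
      (computable_list_map (ho (Computable.snd.comp r3)) (hlamc.comp Computable.snd).to₂))
      (Computable.const none)
    refine Primrec.and.to_comp.comp (hnil.to_comp.comp (ho (Computable.fst.comp hr))) ?_
    refine Primrec.and.to_comp.comp ?_ (hnil.to_comp.comp (ho (Computable.fst.comp r3)))
    exact heq.to_comp.comp (hνc.comp (Computable.fst.comp r2)) (Computable.const _)
  have hFsome : ∀ i l, F i = some l ↔ ((oddL ((symRun (dec i)).1.map ν) = [] ∧
      ν (symRun (dec i)).2.1 = ν [] ∧ oddL ((symRun (dec i)).2.2.1.map ν) = []) ∧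
      (oddL ((symRun (dec i)).2.2.2.map ν)).map lam = l) := by
    intro i l
    simp only [F, Bool.cond_eq_ite, Bool.and_eq_true, decide_eq_true_eq]
    split_ifs with h
    · simp [h]
    · simp only [false_iff]
      exact fun h' => h h'.1
  have hB : ∀ i, i ∈ WordProblem gK ↔ ∃ l, F i = some l ∧ ∀ k ∈ l, k ∈ A := by
    intro i
    have hi : wordCode (dec i) = i := wordCode_symm _ i
    conv_lhs => rw [← hi]
    rw [mem_wordProblem, hone, ← symVal_run]
    generalize hs : symRun (dec i) = s at hFsome
    have h1 := lsum_eq_zero genG hν hG s.1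
    have h2 : evalWord genG s.2.1 = 1 ↔ ν s.2.1 = ν [] := by rw [hν, evalWord_nil]
    have h3 := lsum_eq_zero genG hν hG s.2.2.1
    have h4 := killMap_lsum_eq_zero genG S hν hG s.2.2.2
    have h5 : symVal genG S s = 1 ↔ lsum genG s.1 = 0 ∧ evalWord genG s.2.1 = 1 ∧
        lsum genG s.2.2.1 = 0 ∧ killMap S (lsum genG s.2.2.2) = 0 := by
      rw [TriG.ext_iff]; rfl
    have h6 : (∀ u ∈ s.2.2.2, ν u ∈ oddL (s.2.2.2.map ν) → evalWord genG u ∈ S) ↔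
        ∀ k ∈ (oddL (s.2.2.2.map ν)).map lam, k ∈ A := by
      constructor
      · intro h k hk
        obtain ⟨n, hn, rfl⟩ := List.mem_map.1 hk
        obtain ⟨u, hu, rfl⟩ := List.mem_map.1 (List.mem_of_mem_filter hn)
        rw [hlam]
        exact h u hu hn
      · intro h u hu hn
        have := h _ (List.mem_map_of_mem (f := lam) hn)
        rwa [hlam] at this
    rw [h5, h1, h2, h3, h4, h6]
    constructor
    · rintro ⟨a, b, c, d⟩
      exact ⟨_, (hFsome i _).2 (by rw [hs]; exact ⟨⟨a, b, c⟩, rfl⟩), d⟩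
    · rintro ⟨l, hl, d⟩
      obtain ⟨⟨a, b, c⟩, rfl⟩ := (hFsome i l).1 hl
      rw [hs] at a b c d
      exact ⟨a, b, c, d⟩
  have hbd : ∀ i l k n, F i = some l → k ∈ l → i < 2 ^ n → k < n := by
    intro i l k n hl hk hi
    obtain ⟨-, rfl⟩ := (hFsome i l).1 hl
    obtain ⟨n', hn', rfl⟩ := List.mem_map.1 hk
    obtain ⟨u, hu, rfl⟩ := List.mem_map.1 (List.mem_of_mem_filter hn')
    rw [hlam]
    have h1 := wordNorm_le genG u
    have h2 := (symRun_bound (dec i)).2 u hu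
    have h3 := two_pow_le_code (show 0 < mG + 2 by omega) (dec i)
    rw [show wordCode (dec i) = i from wordCode_symm _ i] at h3
    have h4 : (dec i).length ≤ n :=
      (Nat.pow_le_pow_iff_right (show 1 < 2 by norm_num)).1 (h3.trans hi)
    omega
  -- orders
  have horder : ∀ x : K, 0 < orderOf (x : TriG G S).g ∧ orderOf x ∣ 4 * orderOf (x : TriG G S).g := by
    intro x
    refine ⟨(htG _).orderOf_pos, ?_⟩
    rw [← Subgroup.orderOf_coe]
    exact orderOf_dvd_of_pow_eq_one (TriG.pow_eq_one _)
  refine ⟨K, inferInstance, mG + 2, gK, hgen, sigma_of_queries hA hFc hB, ?_, ⟨4, by norm_num, ?_⟩,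
    ⟨fun n => 2 ^ n, conj_of_queries hFc hB hbd, 2, by norm_num, 0, fun n _ => by simp⟩, ?_⟩
  · intro x
    obtain ⟨h1, h2⟩ := horder x
    exact orderOf_pos_iff.1 (Nat.pos_of_dvd_of_pos h2 (by omega))
  · intro n
    constructor
    · refine csSup_le (torsion_nonempty genG n) ?_
      rintro k ⟨g, hg, rfl⟩
      obtain ⟨w, hw, rfl⟩ := exists_geodesic genG hG g
      refine le_csSup (torsion_bdd gK hgen n) ⟨evalWord gK (w.map toLarge), ?_, ?_⟩
      · refine (wordNorm_le gK _).trans ?_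
        rw [List.length_map, hw]; exact hg
      · rw [← Subgroup.orderOf_coe, hcoe, evalWord_toLarge]
        exact orderOf_injective TriG.incl TriG.incl_injective _
    · refine csSup_le (torsion_nonempty gK n) ?_
      rintro k ⟨x, hx, rfl⟩
      obtain ⟨h1, h2⟩ := horder x
      refine (Nat.le_of_dvd (by omega) h2).trans (Nat.mul_le_mul_left 4 ?_)
      refine le_csSup (torsion_bdd genG hG n) ⟨_, ?_, rfl⟩
      obtain ⟨w, hw, rfl⟩ := exists_geodesic gK hgen x
      rw [hcoe, ← evalWord_toSmall]
      refine (wordNorm_le genG _).trans ((List.length_filterMap_le _ _).trans ?_)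
      rw [hw]; exact hx
  · -- many-one reduction
    have hcomp : Computable₂ fun k n : ℕ => decide (lam (ν ((wordEquiv hm).symm n)) = k) :=
      (PrimrecRel.decide Primrec.eq).to_comp.comp
        (hlamc.comp (hνc.comp ((computable_dec hm).comp Computable.snd))) Computable.fst
    have hex : ∀ k : ℕ, ∃ n, decide (lam (ν ((wordEquiv hm).symm n)) = k) = true := by
      intro k
      obtain ⟨x, hx⟩ := exists_wordNorm_eq genG hG k
      obtain ⟨w, rfl⟩ := exists_word genG hG x
      refine ⟨wordEquiv hm w, ?_⟩
      rw [Equiv.symm_apply_apply, hlam, hx]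
      simp
    have hu : Computable fun k => (wordEquiv hm).symm (Nat.find (hex k)) :=
      (computable_dec hm).comp (computable_find hcomp hex)
    have hh := primrec_halfWord.to_comp.comp hu
    refine ⟨_, primrec_wordCode.to_comp.comp (Computable.list_append.comp hh hh), ?_⟩
    intro k
    rw [mem_wordProblem, hone, evalWord_halfWord]
    have h1 := Nat.find_spec (hex k)
    rw [decide_eq_true_iff, hlam] at h1
    change k ∈ A ↔ wordNorm genG _ ∈ A
    rw [h1]
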